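/- (Appell property, part (i) of Theorem 5.) For all integers a ≥ 0, b ≥ 1 and every integer μ, applying ∂_{w₂} componentwise yields ∂_{w₂} P_{a,b,μ} = P_{a,b−1,μ}. -/

import Mathlib

open MvPolynomial

noncomputable section

/-- The polynomial ring `ℂ[z₁, z₂, w₁, w₂]`, with `X 0 = z₁`, `X 1 = z₂`,
`X 2 = w₁`, `X 3 = w₂` (where `w₁, w₂` play the role of `z̄₁, z̄₂`). -/
abbrev CPoly : Type := MvPolynomial (Fin 4) ℂ

def z1 : CPoly := X 0
def z2 : CPoly := X 1
def w1 : CPoly := X 2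
def w2 : CPoly := X 3

/-- The pair `(F₁, F₂)` of formula (10) of the paper (initial data `A_{a,b-j}`):
`F₁ = Σ_{k=0}^{min(a,b−j)} (−1)^{b−j−k} z₂^k w₂^{k+j} z₁^{a−k} w₁^{b−j−k} /(k!(k+j)!(a−k)!(b−j−k)!)`,
`F₂ = Σ_{k=0}^{min(a,b−j−1)} (−1)^{b−j−k−1} z₂^k w₂^{k+j+1} z₁^{a−k} w₁^{b−j−k−1} /(k!(k+j+1)!(a−k)!(b−j−k−1)!)`,
empty sums being `0`.  (Note `Finset.range (min (a+1) (b-j+1))` is `{0,…,min a (b−j)}`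
and `Finset.range (min (a+1) (b-j))` is `{0,…,min a (b−j−1)}`, empty when `j = b`.) -/
def PA (a b j : ℕ) : CPoly × CPoly :=
  (∑ k ∈ Finset.range (min (a + 1) (b - j + 1)),
      C ((-1 : ℂ) ^ (b - j - k) /
          ((k.factorial : ℂ) * ((k + j).factorial : ℂ) * ((a - k).factorial : ℂ) *
            ((b - j - k).factorial : ℂ)))
        * z2 ^ k * w2 ^ (k + j) * z1 ^ (a - k) * w1 ^ (b - j - k),
   ∑ k ∈ Finset.range (min (a + 1) (b - j)),
      C ((-1 : ℂ) ^ (b - j - k - 1) /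
          ((k.factorial : ℂ) * ((k + j + 1).factorial : ℂ) * ((a - k).factorial : ℂ) *
            ((b - j - k - 1).factorial : ℂ)))
        * z2 ^ k * w2 ^ (k + j + 1) * z1 ^ (a - k) * w1 ^ (b - j - k - 1))

/-- The pair `(F₁, F₂)` of formula (11) of the paper (initial data `B_{a-i,b}`):
`F₁ = Σ_{k=0}^{min(a−i−1,b)} (−1)^{b−k} z₂^{k+i+1} w₂^k z₁^{a−i−k−1} w₁^{b−k} /((k+i+1)!k!(a−i−k−1)!(b−k)!)`,
`F₂ = Σ_{k=0}^{min(a−i,b)} (−1)^{b−k} z₂^{k+i} w₂^k z₁^{a−i−k} w₁^{b−k} /((k+i)!k!(a−i−k)!(b−k)!)`,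
empty sums being `0`.  (Note `Finset.range (min (a-i) (b+1))` is `{0,…,min (a−i−1) b}`,
empty when `i = a`, and `Finset.range (min (a-i+1) (b+1))` is `{0,…,min (a−i) b}`.) -/
def PB (a b i : ℕ) : CPoly × CPoly :=
  (∑ k ∈ Finset.range (min (a - i) (b + 1)),
      C ((-1 : ℂ) ^ (b - k) /
          (((k + i + 1).factorial : ℂ) * (k.factorial : ℂ) * ((a - i - k - 1).factorial : ℂ) *
            ((b - k).factorial : ℂ)))
        * z2 ^ (k + i + 1) * w2 ^ k * z1 ^ (a - i - k - 1) * w1 ^ (b - k),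
   ∑ k ∈ Finset.range (min (a - i + 1) (b + 1)),
      C ((-1 : ℂ) ^ (b - k) /
          (((k + i).factorial : ℂ) * (k.factorial : ℂ) * ((a - i - k).factorial : ℂ) *
            ((b - k).factorial : ℂ)))
        * z2 ^ (k + i) * w2 ^ k * z1 ^ (a - i - k) * w1 ^ (b - k))

/-- The basis pair `P_{a,b,μ}`: for `a+1−b ≤ μ ≤ a+1` it is given by the formula (10)
with `j = μ − a − 1 + b`; for `−b ≤ μ ≤ a−b` by the formula (11) with `i = a − b − μ`;
and it is `(0,0)` for `μ` outside `[−b, a+1]`. -/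
def Ppair (a b : ℕ) (μ : ℤ) : CPoly × CPoly :=
  if (a : ℤ) + 1 - b ≤ μ ∧ μ ≤ (a : ℤ) + 1 then PA a b (μ - a - 1 + b).toNat
  else if -(b : ℤ) ≤ μ ∧ μ ≤ (a : ℤ) - b then PB a b ((a : ℤ) - b - μ).toNat
  else 0

/-- The normalized monomial
`(−1)^s z₂^p w₂^q z₁^r w₁^s / (p! q! r! s!)`. -/
def dividedMonomial (p q r s : ℕ) : CPoly :=
  C ((-1 : ℂ) ^ s /
      ((p.factorial : ℂ) * (q.factorial : ℂ) * (r.factorial : ℂ) * (s.factorial : ℂ)))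
    * z2 ^ p * w2 ^ q * z1 ^ r * w1 ^ s

theorem PA_eq (a b j : ℕ) : PA a b j =
    (∑ k ∈ Finset.range (min (a + 1) (b - j + 1)),
      dividedMonomial k (k + j) (a - k) (b - j - k),
     ∑ k ∈ Finset.range (min (a + 1) (b - j)),
      dividedMonomial k (k + j + 1) (a - k) (b - j - k - 1)) := rfl

theorem PB_eq (a b i : ℕ) : PB a b i =
    (∑ k ∈ Finset.range (min (a - i) (b + 1)),
      dividedMonomial (k + i + 1) k (a - i - k - 1) (b - k),
     ∑ k ∈ Finset.range (min (a - i + 1) (b + 1)),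
      dividedMonomial (k + i) k (a - i - k) (b - k)) := rfl

theorem pderiv_dividedMonomial_zero (p r s : ℕ) :
    pderiv (3 : Fin 4) (dividedMonomial p 0 r s) = 0 := by
  simp [dividedMonomial, z1, z2, w1, Derivation.leibniz_pow, pderiv_X]

theorem pderiv_dividedMonomial_succ (p q r s : ℕ) :
    pderiv (3 : Fin 4) (dividedMonomial p (q + 1) r s) = dividedMonomial p q r s := by
  have hc : ((-1 : ℂ) ^ s / ((p.factorial : ℂ) * (q.factorial : ℂ) * (r.factorial : ℂ) *
        (s.factorial : ℂ)))
      = (-1 : ℂ) ^ s / ((p.factorial : ℂ) * ((q + 1).factorial : ℂ) * (r.factorial : ℂ) *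
        (s.factorial : ℂ)) * ((q + 1 : ℕ) : ℂ) := by
    have hq := Nat.cast_add_one_ne_zero (R := ℂ) q
    rw [Nat.factorial_succ]
    push_cast
    field_simp
  rw [dividedMonomial, dividedMonomial, hc, C_mul, map_natCast]
  simp [z1, z2, w1, w2, Derivation.leibniz_pow, pderiv_X]
  ring

theorem pderiv_PA_succ (a b j : ℕ) :
    Prod.map (pderiv (3 : Fin 4)) (pderiv (3 : Fin 4)) (PA a (b + 1) (j + 1)) = PA a b j := by
  simp only [PA_eq, Prod.map_apply, map_sum, Nat.add_sub_add_right, ← Nat.add_assoc,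
    pderiv_dividedMonomial_succ]

theorem pderiv_sum_dividedMonomial (p r s : ℕ → ℕ) (n : ℕ) :
    pderiv (3 : Fin 4) (∑ k ∈ Finset.range (n + 1), dividedMonomial (p k) k (r k) (s k)) =
      ∑ k ∈ Finset.range n, dividedMonomial (p (k + 1)) k (r (k + 1)) (s (k + 1)) := by
  simp only [Finset.sum_range_succ', map_add, map_sum, pderiv_dividedMonomial_succ,
    pderiv_dividedMonomial_zero, add_zero]

theorem pderiv_PA_zero (a b : ℕ) :
    Prod.map (pderiv (3 : Fin 4)) (pderiv (3 : Fin 4)) (PA a (b + 1) 0) = PB a b 0 := by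
  rw [PA_eq, PB_eq, Nat.add_min_add_right a]
  refine Prod.ext ((pderiv_sum_dividedMonomial _ _ _ _).trans ?_) ?_
  · refine Finset.sum_congr rfl fun k _ => ?_
    congr 1
    omega
  · rw [Prod.map_snd, map_sum]
    refine Finset.sum_congr rfl fun k _ => (pderiv_dividedMonomial_succ _ _ _ _).trans ?_
    congr 1
    omega

theorem pderiv_PB_of_lt {a i : ℕ} (b : ℕ) (h : i < a) :
    Prod.map (pderiv (3 : Fin 4)) (pderiv (3 : Fin 4)) (PB a (b + 1) i) = PB a b (i + 1) := by
  have h' : a - i = a - (i + 1) + 1 := by omega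
  rw [PB_eq, PB_eq, Nat.add_min_add_right, h', Nat.add_min_add_right]
  refine Prod.ext ((pderiv_sum_dividedMonomial _ _ _ _).trans ?_)
    ((pderiv_sum_dividedMonomial _ _ _ _).trans ?_) <;>
  · refine Finset.sum_congr rfl fun k _ => ?_
    congr 1 <;> omega

theorem pderiv_PB_self (a b : ℕ) :
    Prod.map (pderiv (3 : Fin 4)) (pderiv (3 : Fin 4)) (PB a b a) = 0 := by
  simp [PB_eq, pderiv_dividedMonomial_zero]

/-- Appell property (i): for `a ≥ 0`, `b ≥ 1` and every integer `μ`,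
`∂_{w₂} P_{a,b,μ} = P_{a,b−1,μ}` componentwise. -/
theorem Ppair_appell_w2 (a b : ℕ) (hb : 1 ≤ b) (μ : ℤ) :
    (pderiv (3 : Fin 4) (Ppair a b μ).1, pderiv (3 : Fin 4) (Ppair a b μ).2)
      = Ppair a (b - 1) μ := by
  obtain ⟨b, rfl⟩ := Nat.exists_eq_add_of_le' hb
  change Prod.map (pderiv (3 : Fin 4)) (pderiv (3 : Fin 4)) (Ppair a (b + 1) μ) = Ppair a b μ
  by_cases hA : (a : ℤ) + 1 - (b + 1 : ℕ) ≤ μ ∧ μ ≤ (a : ℤ) + 1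
  · rw [Ppair, if_pos hA]
    by_cases hA' : (a : ℤ) + 1 - b ≤ μ ∧ μ ≤ (a : ℤ) + 1
    · rw [Ppair, if_pos hA', ← pderiv_PA_succ a b]
      congr 2
      omega
    · rw [Ppair, if_neg hA', if_pos (by omega),
        show (μ - a - 1 + (b + 1 : ℕ)).toNat = 0 by omega,
        show ((a : ℤ) - b - μ).toNat = 0 by omega, pderiv_PA_zero]
  · rw [Ppair, if_neg hA, Ppair,
      if_neg (show ¬((a : ℤ) + 1 - b ≤ μ ∧ μ ≤ (a : ℤ) + 1) by omega)]
    by_cases hB : -((b + 1 : ℕ) : ℤ) ≤ μ ∧ μ ≤ (a : ℤ) - (b + 1 : ℕ)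
    · rw [if_pos hB]
      by_cases hB' : -(b : ℤ) ≤ μ ∧ μ ≤ (a : ℤ) - b
      · rw [if_pos hB', pderiv_PB_of_lt b (by omega)]
        congr 1
        omega
      · rw [if_neg hB', show ((a : ℤ) - (b + 1 : ℕ) - μ).toNat = a by omega, pderiv_PB_self]
    · rw [if_neg hB, if_neg (by omega)]
      exact Prod.ext (map_zero _) (map_zero _)

end
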